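/- Let λ>0 and b∈(0,1). There exists N∈ℕ, N ≥ 1, such that: Δ_n(λ,b) > 0 for all n ≥ N; the sequence (Ω_n^+(λ,b))_{n≥N} is strictly increasing and converges to Ω_∞^+(λ,b) := I_1(λ)·K_1(λ) − b·Λ_1(λ,b); the sequence (Ω_n^−(λ,b))_{n≥N} is strictly decreasing and converges to Ω_∞^−(λ,b) := Λ_1(λ,b)/b − I_1(λb)·K_1(λb); and for all integers m > n ≥ N one has Ω_∞^−(λ,b) < Ω_m^−(λ,b) < Ω_n^−(λ,b) < Ω_n^+(λ,b) < Ω_m^+(λ,b) < Ω_∞^+(λ,b). -/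

import Mathlib

open Real MeasureTheory Filter

/-- Modified Bessel function of the first kind `I_n`. -/
noncomputable def besselI (n : ℕ) (x : ℝ) : ℝ :=
  ∑' m : ℕ, (x / 2) ^ (n + 2 * m) / ((Nat.factorial m : ℝ) * (Nat.factorial (n + m) : ℝ))

/-- Modified Bessel function of the second kind `K_n`. -/
noncomputable def besselK (n : ℕ) (x : ℝ) : ℝ :=
  ∫ t in Set.Ioi (0 : ℝ), Real.exp (-x * Real.cosh t) * Real.cosh ((n : ℝ) * t)

/-- `Λ_n(λ,b) = I_n(λb) K_n(λ)`. -/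
noncomputable def Lam (n : ℕ) (l b : ℝ) : ℝ := besselI n (l * b) * besselK n l

/-- `Ω_n(x) = I_1(x)K_1(x) − I_n(x)K_n(x)`. -/
noncomputable def Om (n : ℕ) (x : ℝ) : ℝ :=
  besselI 1 x * besselK 1 x - besselI n x * besselK n x

/-- Discriminant `Δ_n(λ,b)`. -/
noncomputable def Del (n : ℕ) (l b : ℝ) : ℝ :=
  (b * (Om n l + Om n (l * b)) - (1 + b ^ 2) * Lam 1 l b) ^ 2 - 4 * b ^ 2 * Lam n l b ^ 2

/-- `B_n(λ,b)`. -/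
noncomputable def Bfun (n : ℕ) (l b : ℝ) : ℝ :=
  (1 - b ^ 2) * Lam 1 l b + b * (Om n l - Om n (l * b))

/-- `Ω_n^+(λ,b)`. -/
noncomputable def OmP (n : ℕ) (l b : ℝ) : ℝ :=
  (Bfun n l b + Real.sqrt (Del n l b)) / (2 * b)

/-- `Ω_n^−(λ,b)`. -/
noncomputable def OmM (n : ℕ) (l b : ℝ) : ℝ :=
  (Bfun n l b - Real.sqrt (Del n l b)) / (2 * b)

/-- The matrix `M_n(λ,b,Ω)`. -/
noncomputable def Mmat (n : ℕ) (l b W : ℝ) : Matrix (Fin 2) (Fin 2) ℝ :=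
  !![Om n l - W - b * Lam 1 l b, b * Lam n l b;
     -Lam n l b, Lam 1 l b - b * (Om n (l * b) + W)]

theorem summable_besselI (n : ℕ) (x : ℝ) :
    Summable fun m : ℕ =>
      (x / 2) ^ (n + 2 * m) / ((Nat.factorial m : ℝ) * (Nat.factorial (n + m) : ℝ)) := by
  have h := (Real.summable_pow_div_factorial ((x / 2) ^ 2)).mul_left (|x / 2| ^ n)
  refine Summable.of_norm_bounded h fun m => ?_
  have h1 : (1 : ℝ) ≤ (Nat.factorial (n + m) : ℝ) := by
    exact_mod_cast Nat.one_le_iff_ne_zero.mpr (Nat.factorial_ne_zero _)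
  have h2 : (0 : ℝ) < (Nat.factorial m : ℝ) := by positivity
  rw [norm_div, norm_pow, Real.norm_eq_abs, pow_add, pow_mul, sq_abs, mul_div_assoc,
    Real.norm_of_nonneg (by positivity)]
  gcongr
  exact le_mul_of_one_le_right h2.le h1

theorem besselI_pos (n : ℕ) {x : ℝ} (hx : 0 < x) : 0 < besselI n x :=
  (summable_besselI n x).tsum_pos (fun m => by positivity) 0 (by positivity)

theorem besselI_recurrence (n : ℕ) {x : ℝ} (hx : 0 < x) :
    besselI n x = besselI (n + 2) x + 2 * (n + 1) / x * besselI (n + 1) x := by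
  unfold besselI
  have hs := (summable_nat_add_iff 1).2 (summable_besselI (n + 1) x)
  rw [(summable_besselI n x).tsum_eq_zero_add, (summable_besselI (n + 1) x).tsum_eq_zero_add,
    mul_add, ← tsum_mul_left, add_left_comm,
    ← (summable_besselI (n + 2) x).tsum_add (hs.mul_left _)]
  congr 1
  · simp only [mul_zero, add_zero, Nat.factorial_succ, Nat.factorial_zero]
    push_cast
    field_simp
    ring
  · congr 1
    ext m
    rw [show n + 1 + (m + 1) = n + m + 1 + 1 by ring, show n + (m + 1) = n + m + 1 by ring,
      show n + 2 + m = n + m + 1 + 1 by ring, Nat.factorial_succ m,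
      Nat.factorial_succ (n + m + 1),
      show n + 2 * (m + 1) = n + 2 + 2 * m by ring,
      show n + 1 + 2 * (m + 1) = n + 2 + 2 * m + 1 by ring, pow_succ _ (n + 2 + 2 * m)]
    push_cast
    field_simp
    ring

theorem besselI_succ_le (n : ℕ) {x : ℝ} (hx : 0 < x) :
    2 * (n + 1) / x * besselI (n + 1) x ≤ besselI n x := by
  have := besselI_recurrence n hx
  have := besselI_pos (n + 2) hx
  linarith

theorem besselI_mul_le (n : ℕ) {x b : ℝ} (hx : 0 < x) (hb0 : 0 < b) (hb1 : b ≤ 1) :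
    besselI n (x * b) ≤ b ^ n * besselI n x := by
  unfold besselI
  rw [← tsum_mul_left]
  refine (summable_besselI n _).tsum_le_tsum (fun m => ?_) ((summable_besselI n x).mul_left _)
  rw [← mul_div_assoc, mul_div_right_comm, mul_pow, mul_comm (b ^ n)]
  have : b ^ (n + 2 * m) ≤ b ^ n := pow_le_pow_of_le_one hb0.le hb1 (by omega)
  gcongr

theorem exp_neg_mul_cosh_mul_cosh_le (n : ℕ) {x : ℝ} (hx : 0 < x) {t : ℝ} (ht : 0 ≤ t) :
    Real.exp (-x * Real.cosh t) * Real.cosh ((n : ℝ) * t) ≤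
      Real.exp ((n + 1) ^ 2 / x) * Real.exp (-t) := by
  have h1 : Real.cosh ((n : ℝ) * t) ≤ Real.exp (n * t) := by
    rw [Real.cosh_eq]
    have : Real.exp (-(n * t)) ≤ Real.exp (n * t) := Real.exp_le_exp.2 (by
      have : 0 ≤ (n : ℝ) * t := by positivity
      linarith)
    linarith
  have h2 : t ^ 2 / 4 ≤ Real.cosh t := by
    have h3 := Real.quadratic_le_exp_of_nonneg ht
    have h4 := Real.add_one_le_exp (-t)
    rw [Real.cosh_eq]
    linarith
  have h5 : -x * Real.cosh t + n * t ≤ (n + 1) ^ 2 / x + -t := by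
    have h6 : (n + 1) * t - x * (t ^ 2 / 4) ≤ ((n : ℝ) + 1) ^ 2 / x := by
      rw [le_div_iff₀ hx]
      nlinarith [sq_nonneg (x * t / 2 - (n + 1))]
    nlinarith
  calc _ ≤ Real.exp (-x * Real.cosh t) * Real.exp (n * t) := by gcongr
    _ ≤ _ := by
      rw [← Real.exp_add, ← Real.exp_add]
      exact Real.exp_le_exp.2 h5

theorem integrableOn_besselK (n : ℕ) {x : ℝ} (hx : 0 < x) :
    IntegrableOn (fun t : ℝ => Real.exp (-x * Real.cosh t) * Real.cosh ((n : ℝ) * t))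
      (Set.Ioi 0) := by
  refine Integrable.mono' ((integrableOn_exp_neg_Ioi 0).const_mul
    (Real.exp ((n + 1) ^ 2 / x))) (by fun_prop) ?_
  refine (ae_restrict_iff' measurableSet_Ioi).2 (Eventually.of_forall fun t ht => ?_)
  rw [Real.norm_of_nonneg (by positivity)]
  exact exp_neg_mul_cosh_mul_cosh_le n hx (le_of_lt ht)

theorem besselK_pos (n : ℕ) {x : ℝ} (hx : 0 < x) : 0 < besselK n x := by
  unfold besselK
  rw [setIntegral_pos_iff_support_of_nonneg_ae (Eventually.of_forall fun t => by positivity)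
    (integrableOn_besselK n hx)]
  rw [Function.support_eq_univ (fun t => by positivity)]
  simp

theorem besselK_antitone (n : ℕ) {x y : ℝ} (hx : 0 < x) (hxy : x ≤ y) :
    besselK n y ≤ besselK n x := by
  refine setIntegral_mono (integrableOn_besselK n (hx.trans_le hxy))
    (integrableOn_besselK n hx) fun t => ?_
  have := Real.cosh_pos t
  dsimp only
  gcongr

theorem besselK_recurrence (n : ℕ) {x : ℝ} (hx : 0 < x) :
    besselK (n + 2) x = besselK n x + 2 * (n + 1) / x * besselK (n + 1) x := by
  let F : ℝ → ℝ := fun t => -(2 / x) * (Real.exp (-x * Real.cosh t) * Real.sinh ((n + 1) * t))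
  have hF : ∀ t, HasDerivAt F
      (Real.exp (-x * Real.cosh t) * Real.cosh (((n + 2 : ℕ) : ℝ) * t) -
        Real.exp (-x * Real.cosh t) * Real.cosh ((n : ℝ) * t) -
        2 * (n + 1) / x * (Real.exp (-x * Real.cosh t) * Real.cosh (((n + 1 : ℕ) : ℝ) * t))) t := by
    intro t
    have h1 := ((Real.hasDerivAt_cosh t).const_mul (-x)).exp
    have h2 := ((hasDerivAt_id t).const_mul ((n : ℝ) + 1)).sinh
    refine ((h1.mul h2).const_mul (-(2 / x))).congr_deriv ?_
    push_cast
    rw [show ((n : ℝ) + 2) * t = (n + 1) * t + t by ring,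
      show (n : ℝ) * t = (n + 1) * t - t by ring, Real.cosh_add, Real.cosh_sub]
    simp only [id]
    field_simp
    ring
  have hint := ((integrableOn_besselK (n + 2) hx).sub (integrableOn_besselK n hx)).sub
    ((integrableOn_besselK (n + 1) hx).const_mul (2 * (n + 1) / x))
  have hlim : Tendsto F atTop (nhds 0) := by
    rw [← mul_zero (-(2 / x))]
    refine Tendsto.const_mul _ ?_
    have hb : Tendsto (fun t : ℝ => Real.exp (((n + 1 : ℕ) + 1) ^ 2 / x) * Real.exp (-t))
        atTop (nhds 0) := by
      simpa using (Real.tendsto_exp_neg_atTop_nhds_zero).const_mul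
        (Real.exp (((n + 1 : ℕ) + 1) ^ 2 / x))
    refine squeeze_zero_norm' ?_ hb
    filter_upwards [eventually_ge_atTop 0] with t ht
    refine le_trans ?_ (exp_neg_mul_cosh_mul_cosh_le (n + 1) hx ht)
    have h0 : 0 ≤ ((n : ℝ) + 1) * t := by positivity
    rw [norm_mul, Real.norm_of_nonneg (Real.exp_pos _).le,
      Real.norm_of_nonneg (Real.sinh_nonneg_iff.2 h0)]
    push_cast
    gcongr
    exact (Real.sinh_lt_cosh _).le
  have h := integral_Ioi_of_hasDerivAt_of_tendsto' (a := 0) (fun t _ => hF t) hint hlim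
  have h' := integral_sub ((integrableOn_besselK (n + 2) hx).sub (integrableOn_besselK n hx))
    ((integrableOn_besselK (n + 1) hx).const_mul (2 * (n + 1) / x))
  simp only [Pi.sub_apply] at h'
  rw [h', integral_sub (integrableOn_besselK (n + 2) hx) (integrableOn_besselK n hx),
    integral_const_mul] at h
  have hF0 : F 0 = 0 := by simp [F]
  rw [hF0] at h
  unfold besselK
  linarith

theorem besselK_mul_le_succ (n : ℕ) {x : ℝ} (hx : 0 < x) :
    2 * (n + 1) / x * besselK (n + 1) x ≤ besselK (n + 2) x := by
  have := besselK_recurrence n hx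
  have := besselK_pos n hx
  linarith

theorem besselI_mul_besselK_cross_eq (n : ℕ) {x : ℝ} (hx : 0 < x) :
    besselI n x * besselK (n + 1) x + besselI (n + 1) x * besselK n x =
      besselI 0 x * besselK 1 x + besselI 1 x * besselK 0 x := by
  induction n with
  | zero => rfl
  | succ n ih =>
    rw [← ih, besselI_recurrence n hx, besselK_recurrence n hx]
    ring

theorem tendsto_besselI_mul_besselK {x : ℝ} (hx : 0 < x) :
    Tendsto (fun n => besselI n x * besselK n x) atTop (nhds 0) := by
  rw [← tendsto_add_atTop_iff_nat 1]
  set C := besselI 0 x * besselK 1 x + besselI 1 x * besselK 0 x with hC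
  have hlim : Tendsto (fun n : ℕ => C * x / 2 * (1 / ((n : ℝ) + 1))) atTop (nhds 0) := by
    simpa using tendsto_one_div_add_atTop_nhds_zero_nat.const_mul (C * x / 2)
  refine squeeze_zero (fun n => (mul_pos (besselI_pos _ hx) (besselK_pos _ hx)).le)
    (fun n => ?_) hlim
  have h1 := besselI_mul_besselK_cross_eq (n + 1) hx
  have h2 := mul_le_mul_of_nonneg_left (besselK_mul_le_succ n hx) (besselI_pos (n + 1) hx).le
  have h3 := mul_pos (besselI_pos (n + 1 + 1) hx) (besselK_pos (n + 1) hx)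
  have h4 : 2 * (n + 1) / x * (besselI (n + 1) x * besselK (n + 1) x) ≤ C := by
    rw [hC, ← h1]
    linarith
  rw [mul_one_div, le_div_iff₀ (by positivity)]
  rw [div_mul_eq_mul_div, div_le_iff₀ hx] at h4
  linarith

theorem eventually_besselI_mul_besselK_succ_lt {x y : ℝ} (hx : 0 < x) (hxy : x ≤ y) :
    ∀ᶠ n : ℕ in atTop,
      besselI (n + 1) x * besselK (n + 1) y < besselI n x * besselK n y := by
  have hy := hx.trans_le hxy
  obtain ⟨M, hM⟩ := exists_nat_gt (y ^ 2 / 4)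
  filter_upwards [eventually_ge_atTop (M + 2)] with n hn
  obtain ⟨k, rfl⟩ := Nat.exists_eq_add_of_le' (le_of_add_le_right hn)
  have hk : y ^ 2 / 4 < k + 1 := by
    have : (M : ℝ) ≤ k := by exact_mod_cast Nat.le_of_add_le_add_right hn
    linarith
  have hK2 := besselK_pos (k + 2) hy
  have hI := besselI_pos (k + 2 + 1) hx
  have h1 := besselI_succ_le (k + 2) hx
  have h2 := besselK_mul_le_succ k hy
  have h3 := besselK_recurrence (k + 1) hy
  push_cast at h1 h3
  rw [div_mul_eq_mul_div, div_le_iff₀ hx] at h1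
  rw [div_mul_eq_mul_div, div_le_iff₀ hy] at h2
  have h4 : besselK (k + 1) y < 2 / y * besselK (k + 2) y := by
    rw [div_mul_eq_mul_div, lt_div_iff₀ hy]
    have h5 : y * besselK (k + 2) y * y < 4 * (k + 1) * besselK (k + 2) y := by
      nlinarith
    nlinarith
  have h6 : besselK (k + 2 + 1) y < 2 * (k + 2 + 1) / y * besselK (k + 2) y := by
    have : besselK (k + 2 + 1) y =
        besselK (k + 1) y + 2 * (k + 1 + 1) / y * besselK (k + 2) y := h3
    rw [this]
    have : 2 * ((k : ℝ) + 2 + 1) / y = 2 / y + 2 * (k + 1 + 1) / y := by ring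
    rw [this]
    linarith
  calc besselI (k + 2 + 1) x * besselK (k + 2 + 1) y
      < besselI (k + 2 + 1) x * (2 * (k + 2 + 1) / y * besselK (k + 2) y) := by gcongr
    _ = 2 * (k + 2 + 1) * besselI (k + 2 + 1) x / y * besselK (k + 2) y := by ring
    _ ≤ besselI (k + 2) x * besselK (k + 2) y := by
      gcongr
      rw [div_le_iff₀ hy]
      exact h1.trans (mul_le_mul_of_nonneg_left hxy (besselI_pos _ hx).le)

theorem tendsto_Lam {l b : ℝ} (hl : 0 < l) (hb0 : 0 < b) (hb1 : b ≤ 1) :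
    Tendsto (fun n => Lam n l b) atTop (nhds 0) := by
  refine squeeze_zero (fun n => (mul_pos (besselI_pos _ (mul_pos hl hb0)) (besselK_pos _ hl)).le)
    (fun n => ?_) (tendsto_besselI_mul_besselK hl)
  refine mul_le_mul_of_nonneg_right ?_ (besselK_pos n hl).le
  exact (besselI_mul_le n hl hb0 hb1).trans
    (mul_le_of_le_one_left (besselI_pos n hl).le (pow_le_one₀ hb0.le hb1))

theorem limiting_discriminant_root_pos {l b : ℝ} (hl : 0 < l) (hb0 : 0 < b) (hb1 : b < 1) :
    0 < b * (besselI 1 l * besselK 1 l + besselI 1 (l * b) * besselK 1 (l * b)) -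
      (1 + b ^ 2) * Lam 1 l b := by
  have hlb := mul_pos hl hb0
  have h1 : Lam 1 l b ≤ b * (besselI 1 l * besselK 1 l) := by
    have := mul_le_mul_of_nonneg_right (besselI_mul_le 1 hl hb0 hb1.le) (besselK_pos 1 hl).le
    unfold Lam
    linarith
  have h2 : Lam 1 l b ≤ besselI 1 (l * b) * besselK 1 (l * b) :=
    mul_le_mul_of_nonneg_left (besselK_antitone 1 hlb (mul_le_of_le_one_right hl.le hb1.le))
      (besselI_pos 1 hlb).le
  have h3 : 0 < Lam 1 l b := mul_pos (besselI_pos 1 hlb) (besselK_pos 1 hl)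
  have h4 := mul_le_mul_of_nonneg_left h2 hb0.le
  have h5 : b ^ 2 * Lam 1 l b < b * Lam 1 l b := by
    gcongr
    nlinarith
  linarith

theorem sqrt_sq_sub_sq_add_le {D D' L L' : ℝ} (hL' : 0 ≤ L') (hLL : L' ≤ L) (hLD : L ≤ D)
    (hDD : D ≤ D') : √(D ^ 2 - L ^ 2) + (D' - D) ≤ √(D' ^ 2 - L' ^ 2) := by
  have h0 : 0 ≤ D ^ 2 - L ^ 2 := by nlinarith
  have h1 := Real.sq_sqrt h0
  have h2 : √(D ^ 2 - L ^ 2) ≤ D := Real.sqrt_le_iff.2 ⟨by linarith, by nlinarith⟩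
  refine Real.le_sqrt_of_sq_le ?_
  nlinarith [mul_nonneg (sub_nonneg.2 h2) (sub_nonneg.2 hDD)]

theorem lt_of_succ_lt_from {f : ℕ → ℝ} {N : ℕ} (h : ∀ n, N ≤ n → f (n + 1) < f n) {n m : ℕ}
    (hn : N ≤ n) (hnm : n < m) : f m < f n := by
  induction m, hnm using Nat.le_induction with
  | base => exact h n hn
  | succ k hk ih => exact (h k (by omega)).trans ih

/-- asymptotic monotonicity of the eigenvalues: `(Ω_n^+)_{n≥N}` is strictly
increasing with limit `Ω_∞^+ = I_1(λ)K_1(λ) − bΛ_1(λ,b)`, `(Ω_n^−)_{n≥N}` is strictly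
decreasing with limit `Ω_∞^− = Λ_1(λ,b)/b − I_1(λb)K_1(λb)`, and the chain of inequalities
`Ω_∞^− < Ω_m^− < Ω_n^− < Ω_n^+ < Ω_m^+ < Ω_∞^+` holds for `N ≤ n < m`. -/
theorem eigenvalues_monotone (l b : ℝ) (hl : 0 < l) (hb : b ∈ Set.Ioo (0:ℝ) 1) :
    ∃ N : ℕ, 1 ≤ N ∧
      (∀ n : ℕ, N ≤ n → 0 < Del n l b) ∧
      (∀ n m : ℕ, N ≤ n → n < m → OmP n l b < OmP m l b) ∧
      Tendsto (fun n : ℕ => OmP n l b) atTop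
        (nhds (besselI 1 l * besselK 1 l - b * Lam 1 l b)) ∧
      (∀ n m : ℕ, N ≤ n → n < m → OmM m l b < OmM n l b) ∧
      Tendsto (fun n : ℕ => OmM n l b) atTop
        (nhds (Lam 1 l b / b - besselI 1 (l * b) * besselK 1 (l * b))) ∧
      (∀ n m : ℕ, N ≤ n → n < m →
        Lam 1 l b / b - besselI 1 (l * b) * besselK 1 (l * b) < OmM m l b ∧
        OmM m l b < OmM n l b ∧
        OmM n l b < OmP n l b ∧
        OmP n l b < OmP m l b ∧
        OmP m l b < besselI 1 l * besselK 1 l - b * Lam 1 l b) := by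
  obtain ⟨hb0, hb1⟩ := hb
  have hlb := mul_pos hl hb0
  set a : ℕ → ℝ := fun n => besselI n l * besselK n l
  set c : ℕ → ℝ := fun n => besselI n (l * b) * besselK n (l * b)
  set L : ℕ → ℝ := fun n => Lam n l b with hL
  set D : ℕ → ℝ := fun n => b * (Om n l + Om n (l * b)) - (1 + b ^ 2) * Lam 1 l b with hD
  set E := b * (a 1 + c 1) - (1 + b ^ 2) * Lam 1 l b with hE
  have hE0 : 0 < E := limiting_discriminant_root_pos hl hb0 hb1
  have hOml : ∀ n, Om n l = a 1 - a n := fun n => rfl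
  have hOmlb : ∀ n, Om n (l * b) = c 1 - c n := fun n => rfl
  have hDE : ∀ n, D n = E - b * (a n + c n) := fun n => by
    simp only [hD, hE, hOml, hOmlb]
    ring
  have hDel : ∀ n, Del n l b = D n ^ 2 - (2 * b * L n) ^ 2 := fun n => by
    simp only [Del, hD, hL]
    ring
  have hB : ∀ n, Bfun n l b = (1 - b ^ 2) * Lam 1 l b + b * (a 1 - c 1) - b * (a n - c n) :=
    fun n => by
      simp only [Bfun, hOml, hOmlb]
      ring
  have hLpos : ∀ n, 0 < L n := fun n => mul_pos (besselI_pos n hlb) (besselK_pos n hl)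
  have halim : Tendsto a atTop (nhds 0) := tendsto_besselI_mul_besselK hl
  have hclim : Tendsto c atTop (nhds 0) := tendsto_besselI_mul_besselK hlb
  have hLlim : Tendsto L atTop (nhds 0) := tendsto_Lam hl hb0 hb1.le
  have hDlim : Tendsto D atTop (nhds E) := by
    rw [funext hDE]
    simpa using tendsto_const_nhds.sub ((halim.add hclim).const_mul b)
  have hgap : ∀ᶠ n in atTop, 2 * b * L n < D n :=
    Tendsto.eventually_lt (by simpa using hLlim.const_mul (2 * b)) hDlim hE0
  have hsqrt : Tendsto (fun n => √(Del n l b)) atTop (nhds E) := by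
    have h := (hDlim.pow 2).sub ((hLlim.const_mul (2 * b)).pow 2)
    have h' := h.sqrt
    simp only [← hDel] at h'
    simpa [Real.sqrt_sq hE0.le] using h'
  have hBlim : Tendsto (fun n => Bfun n l b) atTop
      (nhds ((1 - b ^ 2) * Lam 1 l b + b * (a 1 - c 1))) := by
    rw [funext hB]
    simpa using tendsto_const_nhds.sub ((halim.sub hclim).const_mul b)
  have hPlim : Tendsto (fun n => OmP n l b) atTop (nhds (a 1 - b * Lam 1 l b)) := by
    have h := (hBlim.add hsqrt).div_const (2 * b)
    rwa [show ((1 - b ^ 2) * Lam 1 l b + b * (a 1 - c 1) + E) / (2 * b) = a 1 - b * Lam 1 l b by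
      rw [hE]
      field_simp
      ring] at h
  have hMlim : Tendsto (fun n => OmM n l b) atTop (nhds (Lam 1 l b / b - c 1)) := by
    have h := (hBlim.sub hsqrt).div_const (2 * b)
    rwa [show ((1 - b ^ 2) * Lam 1 l b + b * (a 1 - c 1) - E) / (2 * b) = Lam 1 l b / b - c 1 by
      rw [hE]
      field_simp
      ring] at h
  obtain ⟨N, hN⟩ := eventually_atTop.1 (hgap.and
    ((eventually_besselI_mul_besselK_succ_lt hl le_rfl).and
      ((eventually_besselI_mul_besselK_succ_lt hlb le_rfl).and
        (eventually_besselI_mul_besselK_succ_lt hlb (mul_le_of_le_one_right hl.le hb1.le)))))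
  have hN' : ∀ n, N + 1 ≤ n → N ≤ n := fun n hn => by omega
  have ham : ∀ n m, N + 1 ≤ n → n < m → a m < a n := fun n m hn =>
    lt_of_succ_lt_from (fun k hk => (hN k hk).2.1) (hN' n hn)
  have hcm : ∀ n m, N + 1 ≤ n → n < m → c m < c n := fun n m hn =>
    lt_of_succ_lt_from (fun k hk => (hN k hk).2.2.1) (hN' n hn)
  have hLm : ∀ n m, N + 1 ≤ n → n < m → L m < L n := fun n m hn =>
    lt_of_succ_lt_from (fun k hk => (hN k hk).2.2.2) (hN' n hn)
  have hbL : ∀ n, 0 < 2 * b * L n := fun n => mul_pos (by positivity) (hLpos n)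
  have hDelpos : ∀ n, N + 1 ≤ n → 0 < Del n l b := fun n hn => by
    rw [hDel]
    nlinarith [(hN n (hN' n hn)).1, hbL n]
  have hstep : ∀ n m, N + 1 ≤ n → n < m →
      √(Del n l b) + b * (a n - a m + (c n - c m)) ≤ √(Del m l b) := by
    intro n m hn hnm
    have h1 := ham n m hn hnm
    have h2 := hcm n m hn hnm
    have h3 : D m - D n = b * (a n - a m + (c n - c m)) := by
      rw [hDE, hDE]
      ring
    have h4 : 0 < b * (a n - a m + (c n - c m)) := mul_pos hb0 (by linarith)
    rw [← h3, hDel, hDel]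
    exact sqrt_sq_sub_sq_add_le (hbL m).le
      (mul_le_mul_of_nonneg_left (hLm n m hn hnm).le (by positivity))
      (hN n (hN' n hn)).1.le (by linarith)
  have hP : ∀ n m, N + 1 ≤ n → n < m → OmP n l b < OmP m l b := by
    intro n m hn hnm
    have h1 := mul_pos hb0 (sub_pos.2 (ham n m hn hnm))
    have h2 := hstep n m hn hnm
    unfold OmP
    rw [hB, hB]
    gcongr ?_ / _
    linarith
  have hM : ∀ n m, N + 1 ≤ n → n < m → OmM m l b < OmM n l b := by
    intro n m hn hnm
    have h1 := mul_pos hb0 (sub_pos.2 (hcm n m hn hnm))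
    have h2 := hstep n m hn hnm
    unfold OmM
    rw [hB, hB]
    gcongr ?_ / _
    linarith
  refine ⟨N + 1, by omega, hDelpos, hP, hPlim, hM, hMlim, fun n m hn hnm =>
    ⟨?_, hM n m hn hnm, ?_, hP n m hn hnm, ?_⟩⟩
  · refine (le_of_tendsto hMlim ?_).trans_lt (hM m (m + 1) (by omega) (by omega))
    filter_upwards [eventually_gt_atTop (m + 1)] with k hk
    exact (hM (m + 1) k (by omega) hk).le
  · have := Real.sqrt_pos.2 (hDelpos n hn)
    unfold OmM OmP
    gcongr ?_ / _
    linarith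
  · refine (hP m (m + 1) (by omega) (by omega)).trans_le (ge_of_tendsto hPlim ?_)
    filter_upwards [eventually_gt_atTop (m + 1)] with k hk
    exact (hP (m + 1) k (by omega) hk).le
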